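/- Let R be a commutative ring and x₁,…,xₙ ∈ R a regular sequence. Let M be an object of the derived category D(R) of R-modules whose cohomology is supported on the closed set V(x₁,…,xₙ), i.e. for every integer i, every element of the cohomology module H^i(M) is annihilated by some power of x_j for each j ∈ {1,…,n} (equivalently, each localization H^i(M)[1/x_j] vanishes). Then M is coconnective — H^i(M) = 0 for all i < 0 — if and only if the derived Hom RHom_R(R/(x₁,…,xₙ), M) is coconnective, i.e. the morphism group Hom_{D(R)}(R/(x₁,…,xₙ), M[i]) vanishes for every i < 0. -/

import Mathlib

open CategoryTheory

open Limits Pretriangulated RingTheory.Sequence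

universe w v u t

section Projective

variable {C : Type u} [Category.{v} C] [Abelian C]

namespace CochainComplex

/-- A morphism from a projective object placed in degree zero to a cochain complex is
null-homotopic as soon as it induces zero in cohomology. -/
theorem homotopy_zero_of_homologyMap_eq_zero {P : C} [Projective P] {K : CochainComplex C ℤ}
    (g : (HomologicalComplex.single C (ComplexShape.up ℤ) 0).obj P ⟶ K)
    (hg : HomologicalComplex.homologyMap g 0 = 0) : Nonempty (Homotopy g 0) := by
  let c : P ⟶ K.cycles 0 :=
    (HomologicalComplex.singleObjCyclesSelfIso (ComplexShape.up ℤ) 0 P).inv ≫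
      HomologicalComplex.cyclesMap g 0
  have hc : c ≫ K.homologyπ 0 = 0 := by
    have := HomologicalComplex.homologyπ_naturality g 0
    simp only [c, Category.assoc]
    rw [← this, hg, comp_zero, comp_zero]
  let S : ShortComplex C := ShortComplex.mk _ _ (K.toCycles_comp_homologyπ (-1) 0)
  have hS : S.Exact := ShortComplex.exact_of_g_is_cokernel _
    (K.homologyIsCokernel (-1) 0 (by simp))
  let z : P ⟶ K.X (-1) := hS.liftFromProjective c hc
  have hz' : z ≫ K.toCycles (-1) 0 = c := hS.liftFromProjective_comp c hc
  have hz : z ≫ K.d (-1) 0 =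
      (HomologicalComplex.singleObjXSelf (ComplexShape.up ℤ) 0 P).inv ≫ g.f 0 := by
    rw [← K.toCycles_i, ← Category.assoc, hz']
    simp [c]
  let g' : (singleFunctor C 0).obj P ⟶ K := g
  refine ⟨(HomComplex.Cochain.equivHomotopy g' 0).symm
    ⟨HomComplex.Cochain.fromSingleMk z (by lia), ?_⟩⟩
  rw [HomComplex.Cochain.δ_fromSingleMk z _ 0 0 (by lia), HomComplex.Cochain.ofHom_zero, add_zero,
    hz]
  apply (HomComplex.Cochain.fromSingleEquiv (add_zero 0)).injective
  rw [HomComplex.Cochain.fromSingleEquiv_fromSingleMk]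
  exact congrArg ((HomologicalComplex.singleObjXSelf (ComplexShape.up ℤ) 0 P).inv ≫ ·)
    (HomComplex.Cochain.ofHom_v g' 0)

/-- A morphism from a projective object to the cohomology of a cochain complex in degree zero
is induced by a morphism of complexes. -/
theorem exists_homologyMap_eq {P : C} [Projective P] {K : CochainComplex C ℤ}
    (φ : P ⟶ K.homology 0) :
    ∃ g : (HomologicalComplex.single C (ComplexShape.up ℤ) 0).obj P ⟶ K, φ =
      (HomologicalComplex.singleObjHomologySelfIso (ComplexShape.up ℤ) 0 P).inv ≫
        HomologicalComplex.homologyMap g 0 := by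
  let c : P ⟶ K.cycles 0 := Projective.factorThru φ (K.homologyπ 0)
  let g : (HomologicalComplex.single C (ComplexShape.up ℤ) 0).obj P ⟶ K :=
    HomologicalComplex.mkHomFromSingle (c ≫ K.iCycles 0) (by simp)
  refine ⟨g, ?_⟩
  rw [← HomologicalComplex.singleObjCyclesSelfIso_inv_homologyπ_assoc,
    HomologicalComplex.homologyπ_naturality, ← Category.assoc]
  have : (HomologicalComplex.singleObjCyclesSelfIso (ComplexShape.up ℤ) 0 P).inv ≫
      HomologicalComplex.cyclesMap g 0 = c := by
    rw [← cancel_mono (K.iCycles 0)]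
    simp [g]
  rw [this, Projective.factorThru_comp]

instance isKProjective_single_obj (P : C) [Projective P] :
    IsKProjective ((HomologicalComplex.single C (ComplexShape.up ℤ) 0).obj P) where
  nonempty_homotopy_zero g hL :=
    homotopy_zero_of_homologyMap_eq_zero g ((hL 0).isZero_homology.eq_zero_of_tgt _)

end CochainComplex

namespace DerivedCategory

variable [HasDerivedCategory.{w} C]

instance homologyFunctor_linear (R : Type t) [Ring R] [Linear R C] (n : ℤ) :
    (homologyFunctor C n).Linear R := by
  have : (HomologicalComplex.shortComplexFunctor C (ComplexShape.up ℤ) n).Linear R :=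
    { map_smul _ _ := rfl }
  have : (HomologicalComplex.homologyFunctor C (ComplexShape.up ℤ) n).Linear R :=
    inferInstanceAs ((HomologicalComplex.shortComplexFunctor C (ComplexShape.up ℤ) n ⋙
      ShortComplex.homologyFunctor C).Linear R)
  let : Localization.Lifting Q (HomologicalComplex.quasiIso C (ComplexShape.up ℤ))
    (HomologicalComplex.homologyFunctor C (ComplexShape.up ℤ) n) (homologyFunctor C n) :=
    ⟨homologyFunctorFactors C n⟩
  exact (Localization.functor_linear_iff Q (HomologicalComplex.quasiIso C (ComplexShape.up ℤ)) R
    (HomologicalComplex.homologyFunctor C (ComplexShape.up ℤ) n) (homologyFunctor C n)).1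
    inferInstance

theorem Q_map_surjective_of_isKProjective (K L : CochainComplex C ℤ) [K.IsKProjective] :
    Function.Surjective (Q.map : (K ⟶ L) → (Q.obj K ⟶ Q.obj L)) := by
  intro f
  obtain ⟨g, hg⟩ := (CochainComplex.IsKProjective.Qh_map_bijective K _).surjective
    ((quotientCompQhIso C).hom.app K ≫ f ≫ (quotientCompQhIso C).inv.app L)
  obtain ⟨g, rfl⟩ := (HomotopyCategory.quotient _ _).map_surjective g
  refine ⟨g, ?_⟩
  rw [← cancel_epi ((quotientCompQhIso C).hom.app K), ← quotientCompQhIso_hom_naturality, hg]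
  simp

/-- The cohomology functor in degree zero is faithful on morphisms whose source is a projective
object. -/
theorem eq_zero_of_homologyFunctor_map_eq_zero {P : C} [Projective P] {X : DerivedCategory C}
    (f : Q.obj ((HomologicalComplex.single C (ComplexShape.up ℤ) 0).obj P) ⟶ X)
    (hf : (homologyFunctor C 0).map f = 0) : f = 0 := by
  let e := Q.objObjPreimageIso X
  obtain ⟨g, hg⟩ := Q_map_surjective_of_isKProjective _ _ (f ≫ e.inv)
  have h0 : (HomologicalComplex.homologyFunctor C (ComplexShape.up ℤ) 0).map g = 0 := by
    have := homologyFunctorFactors_hom_naturality g 0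
    rw [hg, Functor.map_comp, hf, zero_comp, zero_comp] at this
    rw [← cancel_epi ((homologyFunctorFactors C 0).hom.app _), comp_zero]
    exact this.symm
  obtain ⟨H⟩ := CochainComplex.homotopy_zero_of_homologyMap_eq_zero g h0
  rw [← cancel_mono e.inv, zero_comp, ← hg, DerivedCategory.Q_map_eq_of_homotopy C H,
    Functor.map_zero]

/-- If there is no nonzero morphism from a projective object to an object of the derived category,
then there is no nonzero morphism to its cohomology in degree zero. -/
theorem hom_homology_eq_zero_of_subsingleton {P : C} [Projective P] {X : DerivedCategory C}
    [Subsingleton (Q.obj ((HomologicalComplex.single C (ComplexShape.up ℤ) 0).obj P) ⟶ X)]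
    (φ : P ⟶ (homologyFunctor C 0).obj X) : φ = 0 := by
  let e := Q.objObjPreimageIso X
  let e' := (homologyFunctor C 0).mapIso e.symm ≪≫ (homologyFunctorFactors C 0).app _
  obtain ⟨g, hg⟩ := CochainComplex.exists_homologyMap_eq (φ ≫ e'.hom)
  have h0 : Q.map g = 0 := by
    rw [← cancel_mono e.hom]
    exact Subsingleton.elim _ _
  have h1 : (HomologicalComplex.homologyFunctor C (ComplexShape.up ℤ) 0).map g = 0 := by
    have := homologyFunctorFactors_hom_naturality g 0
    rw [h0, Functor.map_zero, zero_comp] at this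
    rw [← cancel_epi ((homologyFunctorFactors C 0).hom.app _), comp_zero]
    exact this.symm
  change HomologicalComplex.homologyMap g 0 = 0 at h1
  rw [h1, comp_zero] at hg
  rw [← cancel_mono e'.hom, zero_comp]
  exact hg

end DerivedCategory

end Projective

section Torsion

namespace DerivedCategory

variable {R : Type t} [CommRing R] {C : Type u} [Category.{v} C] [Abelian C] [Linear R C]
  [HasDerivedCategory.{w} C]

/-- Every morphism from `X` to a shift of `M` is annihilated by a power of `r`. -/
def IsPowerTorsionHom (r : R) (X M : DerivedCategory C) : Prop :=
  ∀ (i : ℤ) (f : X ⟶ M⟦i⟧), ∃ N : ℕ, r ^ N • f = 0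

theorem IsPowerTorsionHom.shift {r : R} {X M : DerivedCategory C}
    (h : IsPowerTorsionHom r X M) (n : ℤ) : IsPowerTorsionHom r (X⟦n⟧) M := by
  intro i f
  let e : M⟦i⟧ ≅ (M⟦i - n⟧)⟦n⟧ := (shiftFunctorAdd' (DerivedCategory C) (i - n) n i (by lia)).app M
  obtain ⟨g, hg⟩ := (shiftFunctor (DerivedCategory C) n).map_surjective (f ≫ e.hom)
  obtain ⟨N, hN⟩ := h (i - n) g
  refine ⟨N, ?_⟩
  rw [← cancel_mono e.hom, Linear.smul_comp, ← hg, ← Functor.map_smul, hN, Functor.map_zero,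
    zero_comp]

theorem IsPowerTorsionHom.obj₃ {r : R} {T : Triangle (DerivedCategory C)}
    (hT : T ∈ distTriang (DerivedCategory C)) {M : DerivedCategory C}
    (h₁ : IsPowerTorsionHom r T.obj₁ M) (h₂ : IsPowerTorsionHom r T.obj₂ M) :
    IsPowerTorsionHom r T.obj₃ M := by
  intro i f
  obtain ⟨N, hN⟩ := h₂ i (T.mor₂ ≫ f)
  obtain ⟨g, hg⟩ := Triangle.yoneda_exact₃ T hT (r ^ N • f) (by rw [Linear.comp_smul, hN])
  obtain ⟨N', hN'⟩ := h₁.shift 1 i g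
  exact ⟨N' + N, by rw [pow_add, mul_smul, hg, ← Linear.comp_smul, hN', comp_zero]⟩

end DerivedCategory

end Torsion

section Modules

namespace DerivedCategory

variable {R : Type u} [CommRing R] [HasDerivedCategory.{w} (ModuleCat.{u} R)]

theorem isPowerTorsionHom_self {r : R} {M : DerivedCategory (ModuleCat.{u} R)}
    (h : ∀ (i : ℤ) (m : (homologyFunctor (ModuleCat.{u} R) i).obj M), ∃ N : ℕ, r ^ N • m = 0) :
    IsPowerTorsionHom r ((singleFunctor (ModuleCat.{u} R) 0).obj (ModuleCat.of R R)) M := by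
  intro i f
  let e : (homologyFunctor (ModuleCat.{u} R) 0).obj (M⟦i⟧) ≅
      (homologyFunctor (ModuleCat.{u} R) i).obj M :=
    ((homologyFunctor (ModuleCat.{u} R) 0).shiftIso i 0 i (add_zero i)).app M
  let s : ModuleCat.of R R ≅ (homologyFunctor (ModuleCat.{u} R) 0).obj
      (Q.obj ((HomologicalComplex.single _ (ComplexShape.up ℤ) 0).obj (ModuleCat.of R R))) :=
    (HomologicalComplex.singleObjHomologySelfIso (ComplexShape.up ℤ) 0 _).symm ≪≫
      (homologyFunctorFactors (ModuleCat.{u} R) 0).symm.app _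
  let f' : Q.obj ((HomologicalComplex.single _ (ComplexShape.up ℤ) 0).obj
      (ModuleCat.of R R)) ⟶ M⟦i⟧ := f
  let φ : ModuleCat.of R R ⟶ (homologyFunctor (ModuleCat.{u} R) i).obj M :=
    s.hom ≫ (homologyFunctor (ModuleCat.{u} R) 0).map f' ≫ e.hom
  obtain ⟨N, hN⟩ := h i (φ.hom (1 : R))
  suffices r ^ N • f' = 0 from ⟨N, this⟩
  apply eq_zero_of_homologyFunctor_map_eq_zero
  rw [Functor.map_smul, ← cancel_epi s.hom, ← cancel_mono e.hom]
  simp only [Linear.comp_smul, Linear.smul_comp, Category.assoc, comp_zero, zero_comp]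
  change r ^ N • φ = 0
  ext
  exact hN

theorem isZero_homology_of_subsingleton_hom {M : DerivedCategory (ModuleCat.{u} R)} (i : ℤ)
    [Subsingleton ((singleFunctor (ModuleCat.{u} R) 0).obj (ModuleCat.of R R) ⟶ M⟦i⟧)] :
    IsZero ((homologyFunctor (ModuleCat.{u} R) i).obj M) := by
  let e : (homologyFunctor (ModuleCat.{u} R) 0).obj (M⟦i⟧) ≅
      (homologyFunctor (ModuleCat.{u} R) i).obj M :=
    ((homologyFunctor (ModuleCat.{u} R) 0).shiftIso i 0 i (add_zero i)).app M
  refine IsZero.of_iso ?_ e.symm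
  rw [ModuleCat.isZero_iff_subsingleton]
  refine subsingleton_of_forall_eq 0 fun m ↦ ?_
  have : Subsingleton (Q.obj ((HomologicalComplex.single (ModuleCat.{u} R)
      (ComplexShape.up ℤ) 0).obj (ModuleCat.of R R)) ⟶ M⟦i⟧) := ‹_›
  have h := hom_homology_eq_zero_of_subsingleton (X := M⟦i⟧)
    (ModuleCat.ofHom (LinearMap.toSpanSingleton R _ m))
  simpa using congrArg (fun k ↦ k.hom (1 : R)) h

/-- If the quotient of `A` by a weakly regular sequence has no nonzero morphism to negative shifts
of `M`, and morphisms from `A` to shifts of `M` are torsion with respect to the sequence,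
then `A` has no nonzero morphism to negative shifts of `M`. -/
theorem subsingleton_hom_of_isWeaklyRegular {M : DerivedCategory (ModuleCat.{u} R)}
    {A : Type u} [AddCommGroup A] [Module R A] {rs : List R} (hrs : IsWeaklyRegular A rs)
    (htors : ∀ r ∈ rs, IsPowerTorsionHom r
      ((singleFunctor (ModuleCat.{u} R) 0).obj (ModuleCat.of R A)) M)
    (hquot : ∀ i : ℤ, i < 0 → Subsingleton ((singleFunctor (ModuleCat.{u} R) 0).obj
      (ModuleCat.of R (A ⧸ (Ideal.ofList rs • ⊤ : Submodule R A))) ⟶ M⟦i⟧))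
    (i : ℤ) (hi : i < 0) :
    Subsingleton ((singleFunctor (ModuleCat.{u} R) 0).obj (ModuleCat.of R A) ⟶ M⟦i⟧) := by
  induction rs generalizing A with
  | nil =>
    have := hquot i hi
    let e := (singleFunctor (ModuleCat.{u} R) 0).mapIso
      (Submodule.quotEquivOfEqBot (Ideal.ofList ([] : List R) • ⊤ : Submodule R A)
        (by rw [Ideal.ofList_nil, Submodule.bot_smul (⊤ : Submodule R A)])).toModuleIso
    exact (e.homCongr (Iso.refl (M⟦i⟧))).symm.subsingleton
  | cons r rs ih =>
    obtain ⟨hr, hrs⟩ := (isWeaklyRegular_cons_iff A r rs).1 hrs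
    have hS : ((ModuleCat.of R A).smulShortComplex r).ShortExact := hr.smulShortComplex_shortExact
    have hT := hS.singleTriangle_distinguished
    have := ih hrs
      (fun s hs ↦ IsPowerTorsionHom.obj₃ hT (htors s (by simp [hs])) (htors s (by simp [hs])))
      (fun j hj ↦ by
        have := hquot j hj
        let e := (singleFunctor (ModuleCat.{u} R) 0).mapIso
          (Submodule.quotOfListConsSMulTopEquivQuotSMulTopInner A r rs).toModuleIso
        exact (e.homCongr (Iso.refl (M⟦j⟧))).symm.subsingleton)
    have inj (f : (singleFunctor (ModuleCat.{u} R) 0).obj (ModuleCat.of R A) ⟶ M⟦i⟧)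
        (hf : r • f = 0) : f = 0 := by
      obtain ⟨g, hg⟩ := Triangle.yoneda_exact₂ _ hT f (by
        change (singleFunctor (ModuleCat.{u} R) 0).map (r • 𝟙 (ModuleCat.of R A)) ≫ f = 0
        rw [Functor.map_smul, CategoryTheory.Functor.map_id, Linear.smul_comp, Category.id_comp, hf])
      have hg' : g = 0 := Subsingleton.elim (α := (singleFunctor (ModuleCat.{u} R) 0).obj
        (ModuleCat.of R (QuotSMulTop r A)) ⟶ M⟦i⟧) g 0
      rw [hg, hg']
      exact comp_zero
    refine subsingleton_of_forall_eq 0 fun f ↦ ?_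
    obtain ⟨N, hN⟩ := htors r (by simp) i f
    induction N with
    | zero => simpa using hN
    | succ N ihN => exact ihN (inj _ (by rwa [← mul_smul, ← pow_succ']))

end DerivedCategory

end Modules

/-- **Lemma (lemma-hom-alg).** Let `R` be a commutative ring and `x₁, …, xₙ` a regular
sequence in `R`. Let `M` be an object of the derived category of `R`-modules whose
cohomology modules are supported on `V(x₁, …, xₙ)` (every element of every `H^i M` is
annihilated by a power of each `x j`). Then `M` is coconnective (`H^i M = 0` for `i < 0`)
if and only if `RHom(R/(x₁, …, xₙ), M)` is coconnective, i.e.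
`Hom_{D(R)}(R/(x₁, …, xₙ), M⟦i⟧)` vanishes for all `i < 0`. -/
theorem coconnective_iff_rhom_quotient_coconnective
    {R : Type} [CommRing R] [HasDerivedCategory (ModuleCat R)]
    (n : ℕ) (x : Fin n → R)
    (hreg : RingTheory.Sequence.IsRegular R (List.ofFn x))
    (M : DerivedCategory (ModuleCat R))
    (hsupp : ∀ (i : ℤ) (j : Fin n)
      (m : (DerivedCategory.homologyFunctor (ModuleCat R) i).obj M),
      ∃ N : ℕ, (x j ^ N) • m = 0) :
    (∀ i : ℤ, i < 0 →
      Limits.IsZero ((DerivedCategory.homologyFunctor (ModuleCat R) i).obj M)) ↔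
    (∀ i : ℤ, i < 0 →
      Subsingleton
        ((DerivedCategory.singleFunctor (ModuleCat R) 0).obj
            (ModuleCat.of R (R ⧸ Ideal.span (Set.range x))) ⟶ M⟦i⟧)) := by
  refine ⟨fun h i hi ↦ ?_, fun h i hi ↦ ?_⟩
  · have hM : M.IsGE 0 := (DerivedCategory.isGE_iff M 0).2 h
    have := DerivedCategory.TStructure.t.isGE_shift M 0 i (-i)
    exact subsingleton_of_forall_eq 0 fun f ↦ DerivedCategory.TStructure.t.zero f 0 (-i) (by lia)
  · have := DerivedCategory.subsingleton_hom_of_isWeaklyRegular hreg.toIsWeaklyRegular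
      (fun r hr ↦ by
        obtain ⟨j, rfl⟩ := (List.mem_ofFn' x r).1 hr
        exact DerivedCategory.isPowerTorsionHom_self fun i m ↦ hsupp i j m)
      (fun j hj ↦ by
        have := h j hj
        have hx : (Ideal.ofList (List.ofFn x) • ⊤ : Submodule R R) =
            Ideal.span (Set.range x) := by
          rw [smul_eq_mul, Ideal.mul_top, Ideal.ofList]
          congr 1
          ext r
          simp [List.mem_ofFn']
        rwa [hx]) i hi
    exact DerivedCategory.isZero_homology_of_subsingleton_hom i
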